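/- Let μ and ν be radial Borel probability measures on ℝ³ supported in the closed unit ball. Then for all a, b > 0: 0 ≤ Φ_{μν}(a,b) ≤ a³b³·𝟙(a^{−1}+b^{−1} > 1) ≤ min(a⁶, 4a³) + min(b⁶, 4b³), and Ψ_{μν}(a,b) ≤ 2a³b³·𝟙(a^{−1}+b^{−1} > 1) ≤ min(2a⁶, 8a³) + min(2b⁶, 8b³). Consequently the function f(a) = min(2a⁶, 8a³) belongs to 𝓕_{μν}, and I(μ,ν) ≤ 2^{4/3}·12π; moreover I(μ,μ) ≤ 2^{1/3}·12π. -/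

import Mathlib

open MeasureTheory ENNReal Set Metric Filter Real Topology
open scoped RealInnerProductSpace

noncomputable section

/-- Three-dimensional Euclidean space. -/
abbrev E3 := EuclideanSpace ℝ (Fin 3)

/-- The Coulomb kernel `|x-y|⁻¹`, valued in `ℝ≥0∞` (equal to `∞` on the diagonal). -/
def coul (x y : E3) : ℝ≥0∞ := (ENNReal.ofReal ‖x - y‖)⁻¹

/-- The Coulomb energy `D(ν₁,ν₂) = (1/2)∬ |x-y|⁻¹ dν₁ dν₂`, valued in `ℝ≥0∞`. -/
def DD (ν₁ ν₂ : Measure E3) : ℝ≥0∞ := 2⁻¹ * ∫⁻ x, ∫⁻ y, coul x y ∂ν₂ ∂ν₁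

/-- The real-valued Coulomb energy `D(ν₁,ν₂)`. -/
def Dr (ν₁ ν₂ : Measure E3) : ℝ := (DD ν₁ ν₂).toReal

/-- A measure on `ℝ³` is radial if it is invariant under all linear isometries
(rotations about the origin). -/
def IsRadial (μ : Measure E3) : Prop := ∀ e : E3 ≃ₗᵢ[ℝ] E3, Measure.map e μ = μ

/-- `μ_{v,a}` : the measure `μ` dilated by `1/a` and recentered at `v`, i.e. the pushforward
of `μ` under `u ↦ v + u/a`. -/
def dilate (μ : Measure E3) (v : E3) (a : ℝ) : Measure E3 :=
  Measure.map (fun u => v + a⁻¹ • u) μ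

/-- The first basis vector `e₁ = (1,0,0)`. -/
def e1 : E3 := EuclideanSpace.single (0 : Fin 3) (1 : ℝ)

/-- `Φ_{μν}(a,b) = a³b³(1 - 2D(μ_{0,a}, ν_{e₁,b}))`, extended by `0` when `a = 0` or `b = 0`. -/
def Phi (μ ν : Measure E3) (a b : ℝ) : ℝ :=
  if 0 < a ∧ 0 < b then a ^ 3 * b ^ 3 * (1 - 2 * Dr (dilate μ 0 a) (dilate ν e1 b)) else 0

/-- `Ψ_{μν} = Φ_{μν} + Φ_{νμ} - Φ_{νν}`. -/
def Psi (μ ν : Measure E3) (a b : ℝ) : ℝ := Phi μ ν a b + Phi ν μ a b - Phi ν ν a b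

/-- The class `𝓕_{μν}` of continuous nonnegative functions on `[0,∞)` such that
`Ψ_{μν}(a,b) ≤ f(a)+f(b)` for all `a,b ≥ 0`. -/
def FF (μ ν : Measure E3) : Set (ℝ → ℝ) :=
  {f | ContinuousOn f (Ici 0) ∧ (∀ a, 0 ≤ a → 0 ≤ f a) ∧
    ∀ a b, 0 ≤ a → 0 ≤ b → Psi μ ν a b ≤ f a + f b}

/-- `I(μ,ν) = inf_{f ∈ 𝓕_{μν}} ∫ |z|⁻⁷ f(|z|) dz`. -/
def II (μ ν : Measure E3) : ℝ≥0∞ :=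
  ⨅ f ∈ FF μ ν, ∫⁻ z : E3, ENNReal.ofReal (‖z‖ ^ (-7 : ℝ) * f ‖z‖)

lemma mp3 : MeasurePreserving (fun p : ℝ × (ℝ × ℝ) => (WithLp.toLp 2 ![p.1, p.2.1, p.2.2] : E3)) := by
  have h1 := (volume_preserving_finTwoArrow ℝ).symm
  have h2 := (volume_preserving_piFinSuccAbove (fun _ : Fin 3 => ℝ) 0).symm
  have h3 := PiLp.volume_preserving_toLp (Fin 3)
  have h4 := ((MeasurePreserving.id (volume : Measure ℝ)).prod h1)
  have := h3.comp (h2.comp h4)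
  convert! this using 1
  ext p i
  fin_cases i <;> simp [MeasurableEquiv.piFinSuccAbove, MeasurableEquiv.finTwoArrow, MeasurableEquiv.piFinTwo]

lemma step1 (H : ℝ → ℝ → ℝ≥0∞) (hH : Measurable (Function.uncurry H)) :
    ∫⁻ x : E3, H (x 0) ‖x‖ = ∫⁻ t : ℝ, ∫⁻ w : ℝ × ℝ, H t (√(t^2 + (w.1^2 + w.2^2))) := by
  have hm : Measurable (fun x : E3 => H (x 0) ‖x‖) :=
    hH.comp (Measurable.prodMk (by fun_prop) (by fun_prop))
  rw [← mp3.lintegral_comp hm]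
  have hm2 : Measurable (fun p : ℝ × (ℝ × ℝ) => H p.1 (√(p.1^2 + (p.2.1^2 + p.2.2^2)))) :=
    hH.comp (Measurable.prodMk (by fun_prop) (by fun_prop))
  rw [← lintegral_prod _ hm2.aemeasurable]
  refine lintegral_congr fun p => ?_
  simp [EuclideanSpace.norm_eq, Fin.sum_univ_three, add_assoc]

lemma step2 (g : ℝ → ℝ≥0∞) (hg : Measurable g) (t : ℝ) :
    ∫⁻ w : ℝ × ℝ, g (√(t^2 + (w.1^2 + w.2^2))) =
      ENNReal.ofReal (2 * π) * ∫⁻ s in Ioi |t|, ENNReal.ofReal s * g s := by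
  rw [← lintegral_comp_polarCoord_symm]
  have hm : Measurable (fun r : ℝ => ENNReal.ofReal r * g (√(t^2 + r^2))) := by fun_prop
  have e1 : ∫⁻ p in polarCoord.target, ENNReal.ofReal p.1 •
      (fun w : ℝ × ℝ => g (√(t^2 + (w.1^2 + w.2^2)))) (polarCoord.symm p)
      = ∫⁻ p in (Ioi (0:ℝ)) ×ˢ (Ioo (-π) π), ENNReal.ofReal p.1 * g (√(t^2 + p.1^2)) := by
    rw [polarCoord_target]
    refine lintegral_congr fun p => ?_
    have : (p.1 * cos p.2)^2 + (p.1 * sin p.2)^2 = p.1^2 := by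
      nlinarith [Real.sin_sq_add_cos_sq p.2]
    simp [polarCoord_symm_apply, this]
  rw [e1, Measure.volume_eq_prod, ← Measure.prod_restrict, 
    lintegral_prod (fun p : ℝ × ℝ => ENNReal.ofReal p.1 * g (√(t^2 + p.1^2)))
      (hm.comp measurable_fst).aemeasurable]
  simp only [lintegral_const, Measure.restrict_apply MeasurableSet.univ, univ_inter, Real.volume_Ioo]
  rw [lintegral_mul_const _ hm, mul_comm, sub_neg_eq_add, ← two_mul]
  congr 1
  have himg : (fun r : ℝ => √(t^2 + r^2)) '' Ioi 0 = Ioi |t| := by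
    ext s
    simp only [mem_image, mem_Ioi]
    constructor
    · rintro ⟨r, hr, rfl⟩
      rw [← Real.sqrt_sq_eq_abs]
      exact Real.sqrt_lt_sqrt (sq_nonneg _) (by nlinarith)
    · intro h
      have h0 : 0 < s := (abs_nonneg t).trans_lt h
      have : t^2 < s^2 := by rw [← sq_abs t]; nlinarith [abs_nonneg t]
      refine ⟨√(s^2 - t^2), Real.sqrt_pos.2 (by linarith), ?_⟩
      rw [Real.sq_sqrt (by linarith)]
      simp [Real.sqrt_sq h0.le]
  rw [← himg, lintegral_image_eq_lintegral_abs_deriv_mul (f' := fun r => r / √(t^2+r^2)) measurableSet_Ioi]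
  · refine setLIntegral_congr_fun measurableSet_Ioi fun r hr => ?_
    have hr : 0 < r := hr
    have hp : 0 < √(t^2 + r^2) := Real.sqrt_pos.2 (by positivity)
    rw [← mul_assoc, ← ENNReal.ofReal_mul (abs_nonneg _), abs_of_pos (by positivity), div_mul_cancel₀ _ hp.ne']
  · intro r hr
    have hr : 0 < r := hr
    have : HasDerivAt (fun r : ℝ => t^2 + r^2) (2 * r) r := by
      simpa using (hasDerivAt_pow 2 r).const_add (t^2)
    have := this.sqrt (by positivity)
    convert! this.hasDerivWithinAt using 1
    field_simp
  · intro x hx y hy h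
    have hx : 0 < x := hx
    have hy : 0 < y := hy
    have := (Real.sqrt_inj (by positivity) (by positivity)).1 h
    nlinarith

lemma cyl (H : ℝ → ℝ → ℝ≥0∞) (hH : Measurable (Function.uncurry H)) :
    ∫⁻ x : E3, H (x 0) ‖x‖ = ENNReal.ofReal (2 * π) *
      ∫⁻ s in Ioi (0:ℝ), ENNReal.ofReal s * ∫⁻ t in Ioo (-s) s, H t s := by
  have hH' : ∀ t, Measurable (H t) := fun t => hH.of_uncurry_left
  rw [step1 H hH]
  simp_rw [fun t => step2 (H t) (hH' t) t]
  let K : ℝ → ℝ → ℝ≥0∞ := fun t s => (Ioi |t|).indicator (fun s => ENNReal.ofReal s * H t s) s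
  have hK : Measurable (Function.uncurry K) := by
    have : Function.uncurry K = {p : ℝ × ℝ | |p.1| < p.2}.indicator (fun p => ENNReal.ofReal p.2 * Function.uncurry H p) := by
      ext p
      simp [K, Function.uncurry, indicator]
    rw [this]
    exact Measurable.indicator (by fun_prop) (measurableSet_lt (by fun_prop) (by fun_prop))
  have hK1 : ∀ t, ∫⁻ s in Ioi |t|, ENNReal.ofReal s * H t s = ∫⁻ s, K t s := fun t => by
    rw [← lintegral_indicator measurableSet_Ioi]
  simp_rw [hK1]
  have hK2 : Measurable (fun t => ∫⁻ s, K t s) := hK.lintegral_prod_right'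
  rw [lintegral_const_mul _ hK2, lintegral_lintegral_swap hK.aemeasurable]
  congr 1
  rw [← lintegral_indicator measurableSet_Ioi]
  refine lintegral_congr fun s => ?_
  by_cases hs : 0 < s
  · rw [indicator_of_mem (mem_Ioi.2 hs), ← lintegral_const_mul _ hH.of_uncurry_right, ← lintegral_indicator measurableSet_Ioo]
    refine lintegral_congr fun t => ?_
    simp [K, indicator, abs_lt]
  · rw [indicator_of_notMem (by simpa using hs)]
    have : ∀ t, K t s = 0 := fun t => by
      simp only [K, indicator, mem_Ioi]
      rw [if_neg]; intro h; exact hs ((abs_nonneg t).trans_lt h)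
    simp [this]

lemma scale1 (f : ℝ → ℝ≥0∞) (s : ℝ) (hs : 0 < s) :
    ∫⁻ t in Ioo (-s) s, f (t / s) = ENNReal.ofReal s * ∫⁻ c in Ioo (-1:ℝ) 1, f c := by
  have himg : (fun c : ℝ => s * c) '' Ioo (-1) 1 = Ioo (-s) s := by
    have := image_mul_left_Ioo hs (-1) 1
    simpa using this
  rw [← himg, lintegral_image_eq_lintegral_abs_deriv_mul (f' := fun _ => s) measurableSet_Ioo]
  · rw [abs_of_pos hs, lintegral_const_mul' _ _ ENNReal.ofReal_ne_top]
    congr 1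
    refine lintegral_congr fun c => ?_
    rw [mul_div_cancel_left₀ _ hs.ne']
  · intro c _
    simpa using ((hasDerivAt_id c).const_mul s).hasDerivWithinAt
  · intro x _ y _ h
    exact mul_left_cancel₀ hs.ne' h

/-- half the volume of the unit ball -/
noncomputable def CC : ℝ≥0∞ := ENNReal.ofReal (2 * π) *
      ∫⁻ s in Ioi (0:ℝ), ENNReal.ofReal s * ((Iio (1:ℝ)).indicator 1 s * ENNReal.ofReal s)

lemma archimedes (f : ℝ → ℝ≥0∞) (hf : Measurable f) :
    ∫⁻ x in ball (0:E3) 1, f (x 0 / ‖x‖) = CC * ∫⁻ c in Ioo (-1:ℝ) 1, f c := by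
  let H : ℝ → ℝ → ℝ≥0∞ := fun t s => (Iio (1:ℝ)).indicator 1 s * f (t / s)
  have hi : Measurable ((Iio (1:ℝ)).indicator (1 : ℝ → ℝ≥0∞)) :=
    measurable_one.indicator measurableSet_Iio
  have hH : Measurable (Function.uncurry H) := by
    simp only [H, Function.uncurry_def]
    exact (hi.comp measurable_snd).mul (hf.comp (measurable_fst.div measurable_snd))
  have h := cyl H hH
  rw [← lintegral_indicator measurableSet_ball]
  have e : ∀ x : E3, (ball (0:E3) 1).indicator (fun x => f (x 0 / ‖x‖)) x = H (x 0) ‖x‖ := by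
    intro x
    simp [H, indicator]
  simp_rw [e]
  rw [h, CC, mul_assoc]
  congr 1
  rw [← lintegral_mul_const _ (by fun_prop)]
  refine setLIntegral_congr_fun measurableSet_Ioi fun s hs => ?_
  simp only [H]
  rw [lintegral_const_mul' _ _ (by by_cases h : s < 1 <;> simp [indicator, h]), scale1 f s hs]
  ring

lemma vol_ball_CC : volume (ball (0:E3) 1) = CC * 2 := by
  have := archimedes (fun _ => 1) measurable_const
  simp only [lintegral_one, Measure.restrict_apply MeasurableSet.univ, univ_inter, Real.volume_Ioo] at this
  rw [this]; norm_num

lemma oneD (r s : ℝ) (hr : 0 < r) (hs : 0 ≤ s) :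
    ∫⁻ c in Ioo (-1:ℝ) 1, (ENNReal.ofReal (√(r^2 + s^2 - 2*r*s*c)))⁻¹
      = 2 * (ENNReal.ofReal (max r s))⁻¹ := by
  rcases hs.eq_or_lt with rfl | hs
  · simp [Real.sqrt_sq hr.le, max_eq_left hr.le]
    rw [mul_comm]; norm_num
  have hpos : ∀ c ∈ Ioo (-1:ℝ) 1, 0 < r^2 + s^2 - 2*r*s*c := by
    intro c hc
    have : 0 < r * s := by positivity
    nlinarith [sq_nonneg (r - s), hc.2]
  let G : ℝ → ℝ := fun c => -(r*s)⁻¹ * √(r^2 + s^2 - 2*r*s*c)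
  let g : ℝ → ℝ := fun c => (√(r^2 + s^2 - 2*r*s*c))⁻¹
  have hG : ContinuousOn G (Icc (-1) 1) := by
    apply Continuous.continuousOn; fun_prop
  have hd : ∀ c ∈ Ioo (-1:ℝ) 1, HasDerivAt G (g c) c := by
    intro c hc
    have h0 := hpos c hc
    have h1 : HasDerivAt (fun c => r^2 + s^2 - 2*r*s*c) (-(2*r*s)) c := by
      simpa using ((hasDerivAt_id c).const_mul (2*r*s)).const_sub (r^2+s^2)
    have h2 := (h1.sqrt h0.ne').const_mul (-(r*s)⁻¹)
    convert! h2 using 1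
    simp only [g]
    have := Real.sqrt_pos.2 h0
    field_simp
  have hg0 : ∀ c, 0 ≤ g c := fun c => by positivity
  have hint : IntegrableOn g (Ioc (-1) 1) :=
    intervalIntegral.integrableOn_deriv_of_nonneg hG hd (fun c _ => hg0 c)
  have hI : ∫ c in (-1:ℝ)..1, g c = G 1 - G (-1) :=
    intervalIntegral.integral_eq_sub_of_hasDerivAt_of_le (by norm_num) hG hd
      ((intervalIntegrable_iff_integrableOn_Ioc_of_le (by norm_num)).2 hint)
  rw [intervalIntegral.integral_of_le (by norm_num), integral_Ioc_eq_integral_Ioo] at hI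
  have e : ∫⁻ c in Ioo (-1:ℝ) 1, (ENNReal.ofReal (√(r^2 + s^2 - 2*r*s*c)))⁻¹
      = ∫⁻ c in Ioo (-1:ℝ) 1, ENNReal.ofReal (g c) := by
    refine setLIntegral_congr_fun measurableSet_Ioo fun c hc => ?_
    simp only [g]
    rw [ENNReal.ofReal_inv_of_pos (Real.sqrt_pos.2 (hpos c hc))]
  rw [e, ← ofReal_integral_eq_lintegral_ofReal (hint.mono_set Ioo_subset_Ioc_self)
    (ae_of_all _ hg0), hI]
  have hm : 0 < max r s := lt_max_of_lt_left hr
  rw [← ENNReal.ofReal_inv_of_pos hm, show (2:ℝ≥0∞) = ENNReal.ofReal 2 by simp,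
    ← ENNReal.ofReal_mul (by norm_num)]
  congr 1
  simp only [G]
  rw [show r^2 + s^2 - 2*r*s*1 = (r-s)^2 by ring, show r^2 + s^2 - 2*r*s*(-1) = (r+s)^2 by ring,
    Real.sqrt_sq_eq_abs, Real.sqrt_sq (by positivity)]
  rcases le_total r s with h | h
  · rw [max_eq_right h, abs_of_nonpos (by linarith)]; field_simp; ring
  · rw [max_eq_left h, abs_of_nonneg (by linarith)]; field_simp; ring

lemma exists_isom (x y : E3) (h : ‖x‖ = ‖y‖) : ∃ e : E3 ≃ₗᵢ[ℝ] E3, e x = y :=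
  ⟨(Submodule.span ℝ {x - y})ᗮ.reflection, Submodule.reflection_sub h⟩

lemma measurable_coul : Measurable (fun p : E3 × E3 => coul p.1 p.2) := by
  unfold coul; fun_prop

lemma norm_e1 : ‖e1‖ = 1 := by simp [e1]

lemma avg (r : ℝ) (hr : 0 < r) (y : E3) :
    ∫⁻ x in ball (0:E3) 1, coul ((r / ‖x‖) • x) y = CC * (2 * (ENNReal.ofReal (max r ‖y‖))⁻¹) := by
  obtain ⟨e, he⟩ := exists_isom y (‖y‖ • e1) (by simp [norm_smul, norm_e1])
  rw [← oneD r ‖y‖ hr (norm_nonneg y), ← archimedes _ (by fun_prop)]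
  rw [← lintegral_indicator measurableSet_ball, ← lintegral_indicator measurableSet_ball,
    ← e.measurePreserving.lintegral_comp (f := (ball (0:E3) 1).indicator (fun x : E3 =>
        (ENNReal.ofReal (√(r^2 + ‖y‖^2 - 2*r*‖y‖*(x 0 / ‖x‖))))⁻¹))
      (Measurable.indicator (by fun_prop) measurableSet_ball)]
  have h0 : ∀ᵐ x : E3, x ≠ 0 := by simp [ae_iff]
  refine lintegral_congr_ae (h0.mono fun x hx => ?_)
  have hxp : 0 < ‖x‖ := norm_pos_iff.2 hx
  simp only [indicator, mem_ball_zero_iff, e.norm_map]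
  split_ifs with hb
  swap; rfl
  unfold coul
  congr 2
  rw [← e.norm_map, map_sub, map_smul, he, ← Real.sqrt_sq (norm_nonneg _)]
  congr 1
  rw [norm_sub_sq_real, norm_smul, norm_smul, norm_e1, e.norm_map, inner_smul_left, inner_smul_right]
  have : inner ℝ (e x) e1 = (e x) 0 := by simp [e1, EuclideanSpace.inner_single_right]
  rw [this]
  simp only [norm_div, norm_norm, Real.norm_of_nonneg hr.le, conj_trivial]
  field_simp
  ring

lemma newton (μ : Measure E3) [IsProbabilityMeasure μ] (hμ : IsRadial μ) (x : E3) (hx : x ≠ 0) :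
    ∫⁻ y, coul x y ∂μ = ∫⁻ y, (ENNReal.ofReal (max ‖x‖ ‖y‖))⁻¹ ∂μ := by
  have hr : 0 < ‖x‖ := norm_pos_iff.2 hx
  have hrad : ∀ z : E3, ‖z‖ = ‖x‖ → ∫⁻ y, coul z y ∂μ = ∫⁻ y, coul x y ∂μ := by
    intro z hz
    obtain ⟨e, he⟩ := exists_isom z x hz
    conv_rhs => rw [← hμ e, lintegral_map (by unfold coul; fun_prop) e.continuous.measurable]
    refine lintegral_congr fun y => ?_
    rw [coul, coul, ← he, ← map_sub, e.norm_map]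
  have h0 : ∀ᵐ x : E3 ∂(volume.restrict (ball (0:E3) 1)), x ≠ 0 :=
    ae_restrict_of_ae (by simp [ae_iff])
  have h1 : ∫⁻ z in ball (0:E3) 1, ∫⁻ y, coul ((‖x‖ / ‖z‖) • z) y ∂μ
      = (∫⁻ y, coul x y ∂μ) * volume (ball (0:E3) 1) := by
    rw [← setLIntegral_const]
    refine lintegral_congr_ae (h0.mono fun z hz => hrad _ ?_)
    have : 0 < ‖z‖ := norm_pos_iff.2 hz
    rw [norm_smul, norm_div, norm_norm, norm_norm]; field_simp
  have h2 : ∫⁻ z in ball (0:E3) 1, ∫⁻ y, coul ((‖x‖ / ‖z‖) • z) y ∂μ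
      = (∫⁻ y, (ENNReal.ofReal (max ‖x‖ ‖y‖))⁻¹ ∂μ) * volume (ball (0:E3) 1) := by
    have hm : Measurable (fun p : E3 × E3 => coul ((‖x‖ / ‖p.1‖) • p.1) p.2) := by
      unfold coul; fun_prop
    rw [lintegral_lintegral_swap (f := fun z y => coul ((‖x‖ / ‖z‖) • z) y) hm.aemeasurable]
    have hm2 : Measurable (fun y : E3 => (ENNReal.ofReal (max ‖x‖ ‖y‖))⁻¹) := by fun_prop
    rw [vol_ball_CC, ← lintegral_mul_const _ hm2]
    refine lintegral_congr fun y => ?_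
    rw [avg _ hr]
    generalize (ENNReal.ofReal (max ‖x‖ ‖y‖))⁻¹ = q
    ring
  have hv0 : volume (ball (0:E3) 1) ≠ 0 := (measure_ball_pos _ _ one_pos).ne'
  have hv1 : volume (ball (0:E3) 1) ≠ ∞ := measure_ball_lt_top.ne
  exact (ENNReal.mul_left_inj hv0 hv1).1 (h1.symm.trans h2)

lemma newton_le (μ : Measure E3) [IsProbabilityMeasure μ] (hμ : IsRadial μ) (x : E3) :
    ∫⁻ y, coul x y ∂μ ≤ (ENNReal.ofReal ‖x‖)⁻¹ := by
  by_cases hx : x = 0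
  · simp [hx]
  rw [newton μ hμ x hx]
  calc _ ≤ ∫⁻ y, (ENNReal.ofReal ‖x‖)⁻¹ ∂μ := lintegral_mono fun y =>
        ENNReal.inv_le_inv.2 (ENNReal.ofReal_le_ofReal (le_max_left _ _))
    _ = _ := by simp

lemma newton_eq (μ : Measure E3) [IsProbabilityMeasure μ] (hμ : IsRadial μ) (x : E3)
    (hx : x ≠ 0) (hs : ∀ᵐ y ∂μ, ‖y‖ ≤ ‖x‖) :
    ∫⁻ y, coul x y ∂μ = (ENNReal.ofReal ‖x‖)⁻¹ := by
  rw [newton μ hμ x hx]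
  calc _ = ∫⁻ y, (ENNReal.ofReal ‖x‖)⁻¹ ∂μ :=
        lintegral_congr_ae (hs.mono fun y hy => by simp only [max_eq_left hy])
    _ = _ := by simp

lemma dilate_prob (μ : Measure E3) [IsProbabilityMeasure μ] (v : E3) (a : ℝ) :
    IsProbabilityMeasure (dilate μ v a) :=
  Measure.isProbabilityMeasure_map (by fun_prop)

lemma dilate_radial (μ : Measure E3) (hμ : IsRadial μ) (a : ℝ) : IsRadial (dilate μ 0 a) := by
  intro e
  have he : Measurable e := e.continuous.measurable
  unfold dilate
  conv_rhs => rw [← hμ e]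
  rw [Measure.map_map he (by fun_prop), Measure.map_map (by fun_prop) he]
  congr 1
  ext1 u
  simp

lemma dilate_supp (μ : Measure E3) (hs : μ (closedBall (0:E3) 1)ᶜ = 0) (a : ℝ) :
    ∀ᵐ x ∂(dilate μ 0 a), ‖x‖ ≤ |a|⁻¹ := by
  unfold dilate
  rw [ae_map_iff (by fun_prop) (measurableSet_le (by fun_prop) (by fun_prop))]
  have : ∀ᵐ x ∂μ, x ∈ closedBall (0:E3) 1 := by rw [ae_iff]; exact hs
  refine this.mono fun x hx => ?_
  rw [mem_closedBall_zero_iff] at hx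
  rw [zero_add, norm_smul, norm_inv, Real.norm_eq_abs]
  have : 0 ≤ |a|⁻¹ := by positivity
  nlinarith

lemma coul_comm (x y : E3) : coul x y = coul y x := by
  rw [coul, coul, norm_sub_rev]

lemma inner_eq (ν : Measure E3) (b : ℝ) :
    ∫⁻ y, (ENNReal.ofReal ‖y‖)⁻¹ ∂(dilate ν e1 b) = ∫⁻ z, coul e1 z ∂(dilate ν 0 (-b)) := by
  unfold dilate
  rw [lintegral_map (by fun_prop) (by fun_prop),
    lintegral_map (by unfold coul; fun_prop) (by fun_prop)]
  refine lintegral_congr fun w => ?_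
  rw [coul]
  congr 3
  rw [zero_add, inv_neg, neg_smul, sub_neg_eq_add]

lemma two_DD (μ ν : Measure E3) [IsProbabilityMeasure μ] [IsProbabilityMeasure ν] (a b : ℝ) :
    2 * DD (dilate μ 0 a) (dilate ν e1 b) =
      ∫⁻ y, ∫⁻ x, coul y x ∂(dilate μ 0 a) ∂(dilate ν e1 b) := by
  haveI := dilate_prob μ 0 a
  haveI := dilate_prob ν e1 b
  rw [DD, ← mul_assoc, ENNReal.mul_inv_cancel (by norm_num) (by norm_num), one_mul,
    lintegral_lintegral_swap (f := fun x y => coul x y) measurable_coul.aemeasurable]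
  simp_rw [fun x y => coul_comm x y]

lemma DD_le (μ ν : Measure E3) [IsProbabilityMeasure μ] [IsProbabilityMeasure ν]
    (hμ : IsRadial μ) (hν : IsRadial ν) (a b : ℝ) :
    2 * DD (dilate μ 0 a) (dilate ν e1 b) ≤ 1 := by
  haveI := dilate_prob μ 0 a
  haveI := dilate_prob ν 0 (-b)
  rw [two_DD]
  calc _ ≤ ∫⁻ y, (ENNReal.ofReal ‖y‖)⁻¹ ∂(dilate ν e1 b) :=
        lintegral_mono fun y => newton_le _ (dilate_radial μ hμ a) y
    _ = _ := inner_eq ν b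
    _ ≤ _ := newton_le _ (dilate_radial ν hν (-b)) e1
    _ = 1 := by simp [norm_e1]

lemma DD_eq (μ ν : Measure E3) [IsProbabilityMeasure μ] [IsProbabilityMeasure ν]
    (hμ : IsRadial μ) (hν : IsRadial ν)
    (hμs : μ (closedBall (0:E3) 1)ᶜ = 0) (hνs : ν (closedBall (0:E3) 1)ᶜ = 0) (a b : ℝ)
    (ha : 0 < a) (hb : 0 < b) (hab : a⁻¹ + b⁻¹ ≤ 1) :
    2 * DD (dilate μ 0 a) (dilate ν e1 b) = 1 := by
  haveI := dilate_prob μ 0 a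
  haveI := dilate_prob ν 0 (-b)
  have ha' : 0 < a⁻¹ := by positivity
  have hb' : 0 < b⁻¹ := by positivity
  rw [two_DD]
  have hsupp : ∀ᵐ y ∂(dilate ν e1 b), a⁻¹ ≤ ‖y‖ := by
    unfold dilate
    rw [ae_map_iff (by fun_prop) (measurableSet_le (by fun_prop) (by fun_prop))]
    have : ∀ᵐ x ∂ν, x ∈ closedBall (0:E3) 1 := by rw [ae_iff]; exact hνs
    refine this.mono fun x hx => ?_
    rw [mem_closedBall_zero_iff] at hx
    have h1 : ‖e1‖ - ‖b⁻¹ • x‖ ≤ ‖e1 + b⁻¹ • x‖ := by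
      have := norm_sub_norm_le e1 (-(b⁻¹ • x))
      simpa using this
    rw [norm_e1, norm_smul, Real.norm_of_nonneg hb'.le] at h1
    nlinarith
  calc _ = ∫⁻ y, (ENNReal.ofReal ‖y‖)⁻¹ ∂(dilate ν e1 b) := by
        refine lintegral_congr_ae (hsupp.mono fun y hy => newton_eq _ (dilate_radial μ hμ a) y ?_ ?_)
        · exact norm_pos_iff.1 (ha'.trans_le hy)
        · refine (dilate_supp μ hμs a).mono fun x hx => ?_
          rw [abs_of_pos ha] at hx
          exact hx.trans hy
    _ = _ := inner_eq ν b
    _ = (ENNReal.ofReal ‖e1‖)⁻¹ := by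
        refine newton_eq _ (dilate_radial ν hν (-b)) e1 ?_ ?_
        · exact norm_pos_iff.1 (by rw [norm_e1]; norm_num)
        · refine (dilate_supp ν hνs (-b)).mono fun x hx => ?_
          rw [abs_neg, abs_of_pos hb] at hx
          rw [norm_e1]; linarith
    _ = 1 := by simp [norm_e1]

lemma two_Dr (ν₁ ν₂ : Measure E3) : 2 * Dr ν₁ ν₂ = (2 * DD ν₁ ν₂).toReal := by
  simp [Dr]

lemma Phi_nonneg (μ ν : Measure E3) [IsProbabilityMeasure μ] [IsProbabilityMeasure ν]
    (hμ : IsRadial μ) (hν : IsRadial ν) (a b : ℝ) : 0 ≤ Phi μ ν a b := by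
  unfold Phi
  split_ifs with h
  · obtain ⟨ha, hb⟩ := h
    rw [two_Dr]
    have : (2 * DD (dilate μ 0 a) (dilate ν e1 b)).toReal ≤ 1 :=
      ENNReal.toReal_le_of_le_ofReal (by norm_num) (by simpa using DD_le μ ν hμ hν a b)
    have : 0 ≤ 1 - (2 * DD (dilate μ 0 a) (dilate ν e1 b)).toReal := by linarith
    positivity
  · exact le_rfl

lemma Phi_le (μ ν : Measure E3) [IsProbabilityMeasure μ] [IsProbabilityMeasure ν]
    (hμ : IsRadial μ) (hν : IsRadial ν)
    (hμs : μ (closedBall (0:E3) 1)ᶜ = 0) (hνs : ν (closedBall (0:E3) 1)ᶜ = 0) (a b : ℝ)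
    (ha : 0 < a) (hb : 0 < b) :
    Phi μ ν a b ≤ (if 1 < a⁻¹ + b⁻¹ then a ^ 3 * b ^ 3 else 0) := by
  rw [Phi, if_pos ⟨ha, hb⟩, two_Dr]
  split_ifs with h
  · have : 0 ≤ (2 * DD (dilate μ 0 a) (dilate ν e1 b)).toReal := ENNReal.toReal_nonneg
    have h3 : 0 < a^3 * b^3 := by positivity
    nlinarith
  · rw [DD_eq μ ν hμ hν hμs hνs a b ha hb (not_lt.1 h)]
    simp

lemma elem_ineq (a b : ℝ) (ha : 0 < a) (hb : 0 < b) :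
    (if 1 < a⁻¹ + b⁻¹ then a ^ 3 * b ^ 3 else 0) ≤
        min (a ^ 6) (4 * a ^ 3) + min (b ^ 6) (4 * b ^ 3) := by
  split_ifs with h
  · have hab : a * b < a + b := by
      have : a⁻¹ + b⁻¹ = (a + b) / (a * b) := by field_simp; ring
      rw [this, lt_div_iff₀ (by positivity)] at h
      linarith
    have hcube : (a * b)^3 ≤ 4 * (a^3 + b^3) := by
      have h1 : (a*b)^3 ≤ (a+b)^3 := pow_le_pow_left₀ (by positivity) hab.le 3
      nlinarith [mul_nonneg (add_pos ha hb).le (sq_nonneg (a - b))]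
    have hA : 0 < a^3 := by positivity
    have hB : 0 < b^3 := by positivity
    have ea : a^6 = a^3 * a^3 := by ring
    have eb : b^6 = b^3 * b^3 := by ring
    have ec : (a*b)^3 = a^3 * b^3 := by ring
    rw [ea, eb]
    rw [ec] at hcube
    generalize a^3 = A at *
    generalize b^3 = B at *
    rcases le_total A 4 with h1 | h1 <;> rcases le_total B 4 with h2 | h2
    · rw [min_eq_left (by nlinarith), min_eq_left (by nlinarith)]; nlinarith [sq_nonneg (A - B)]
    · rw [min_eq_left (by nlinarith), min_eq_right (by nlinarith)]; nlinarith
    · rw [min_eq_right (by nlinarith), min_eq_left (by nlinarith)]; nlinarith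
    · rw [min_eq_right (by nlinarith), min_eq_right (by nlinarith)]; nlinarith
  · positivity

lemma min_two (a : ℝ) : min (2 * a^6) (8 * a^3) = 2 * min (a^6) (4 * a^3) := by
  rw [mul_min_of_nonneg _ _ (by norm_num)]; congr 1; ring

lemma elem_ineq2 (a b : ℝ) (ha : 0 < a) (hb : 0 < b) :
    (if 1 < a⁻¹ + b⁻¹ then 2 * a ^ 3 * b ^ 3 else 0) ≤
        min (2 * a ^ 6) (8 * a ^ 3) + min (2 * b ^ 6) (8 * b ^ 3) := by
  have := elem_ineq a b ha hb
  rw [min_two, min_two]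
  split_ifs at this ⊢ <;> linarith

lemma integral_bound (k : ℝ) (hk : 0 < k) :
    ∫⁻ z : E3, ENNReal.ofReal (‖z‖ ^ (-7 : ℝ) * (k * min (‖z‖^6) (4 * ‖z‖^3)))
      ≤ ENNReal.ofReal (k * (2 ^ ((1:ℝ)/3) * 12 * π)) := by
  have h := cyl (fun _ s => ENNReal.ofReal (s ^ (-7 : ℝ) * (k * min (s^6) (4 * s^3))))
    (by simp only [Function.uncurry_def]; fun_prop)
  rw [h]
  simp only [setLIntegral_const, Real.volume_Ioo]
  set A : ℝ := 4 ^ ((1:ℝ)/3) with hA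
  have hA0 : 0 < A := by positivity
  have hA3 : A^3 = 4 := by
    rw [hA, ← Real.rpow_natCast, ← Real.rpow_mul (by norm_num)]; norm_num
  have hA2 : A^2 = 2 * 2 ^ ((1:ℝ)/3) := by
    rw [hA, ← Real.rpow_natCast, ← Real.rpow_mul (by norm_num),
      show (4:ℝ) = 2 ^ (2:ℝ) by norm_num, ← Real.rpow_mul (by norm_num)]
    have : (2:ℝ) * 2 ^ ((1:ℝ)/3) = 2 ^ (1:ℝ) * 2 ^ ((1:ℝ)/3) := by rw [Real.rpow_one]
    rw [this, ← Real.rpow_add (by norm_num)]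
    norm_num
  have hr7 : ∀ s : ℝ, 0 < s → s ^ (-7:ℝ) = (s^7)⁻¹ := by
    intro s hs
    rw [Real.rpow_neg hs.le]; norm_cast
  have hI1 : ∫⁻ s in Ioc 0 A, ENNReal.ofReal s *
      (ENNReal.ofReal (s ^ (-7 : ℝ) * (k * min (s^6) (4 * s^3))) * ENNReal.ofReal (s - -s))
      ≤ ENNReal.ofReal (k * A^2) := by
    have hc : Continuous (fun s : ℝ => 2 * k * s) := by fun_prop
    have hint : IntegrableOn (fun s : ℝ => 2 * k * s) (Ioc 0 A) :=
      (hc.integrableOn_Icc).mono_set Ioc_subset_Icc_self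
    have hv : ∫ s in Ioc 0 A, 2 * k * s = k * A^2 := by
      rw [← intervalIntegral.integral_of_le hA0.le, intervalIntegral.integral_const_mul, integral_id]
      ring
    rw [← hv, ofReal_integral_eq_lintegral_ofReal hint
      ((ae_restrict_iff' measurableSet_Ioc).2 (ae_of_all _ fun s hs => by
        have := hs.1; simp only [Pi.zero_apply]; positivity))]
    refine setLIntegral_mono (by fun_prop) fun s hs => ?_
    have hs0 : 0 < s := hs.1
    have hm : min (s^6) (4*s^3) ≤ s^6 := min_le_left _ _
    rw [hr7 s hs0, ← ENNReal.ofReal_mul (by positivity), ← ENNReal.ofReal_mul (by positivity)]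
    apply ENNReal.ofReal_le_ofReal
    calc _ ≤ s * ((s^7)⁻¹ * (k * s^6) * (s - -s)) := by
          have : 0 ≤ s - -s := by linarith
          gcongr
      _ = _ := by field_simp; ring
  have hI2 : ∫⁻ s in Ioi A, ENNReal.ofReal s *
      (ENNReal.ofReal (s ^ (-7 : ℝ) * (k * min (s^6) (4 * s^3))) * ENNReal.ofReal (s - -s))
      ≤ ENNReal.ofReal (2 * k * A^2) := by
    have hint : IntegrableOn (fun s : ℝ => 8 * k * s ^ (-2:ℝ)) (Ioi A) :=
      (integrableOn_Ioi_rpow_of_lt (by norm_num) hA0).const_mul _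
    have hv : ∫ s in Ioi A, 8 * k * s ^ (-2:ℝ) = 2 * k * A^2 := by
      rw [integral_const_mul, integral_Ioi_rpow_of_lt (by norm_num) hA0,
        show (-2:ℝ) + 1 = -1 by norm_num, Real.rpow_neg_one]
      field_simp
      rw [hA3]; ring
    rw [← hv, ofReal_integral_eq_lintegral_ofReal hint
      ((ae_restrict_iff' measurableSet_Ioi).2 (ae_of_all _ fun s hs => by
        have : 0 < s := hA0.trans hs
        simp only [Pi.zero_apply]; positivity))]
    refine setLIntegral_mono (by fun_prop) fun s hs => ?_
    have hs0 : 0 < s := hA0.trans hs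
    have hm : min (s^6) (4*s^3) ≤ 4*s^3 := min_le_right _ _
    rw [hr7 s hs0, ← ENNReal.ofReal_mul (by positivity), ← ENNReal.ofReal_mul (by positivity)]
    apply ENNReal.ofReal_le_ofReal
    calc _ ≤ s * ((s^7)⁻¹ * (k * (4*s^3)) * (s - -s)) := by
          have : 0 ≤ s - -s := by linarith
          gcongr
      _ = _ := by
          rw [Real.rpow_neg hs0.le, show (2:ℝ) = ((2:ℕ):ℝ) by norm_num, Real.rpow_natCast]
          field_simp; push_cast; ring
  rw [← Ioc_union_Ioi_eq_Ioi hA0.le]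
  calc _ ≤ ENNReal.ofReal (2*π) * (ENNReal.ofReal (k * A^2) + ENNReal.ofReal (2 * k * A^2)) := by
        gcongr
        exact (lintegral_union_le _ _ _).trans (add_le_add hI1 hI2)
    _ = _ := by
        rw [← ENNReal.ofReal_add (by positivity) (by positivity),
          ← ENNReal.ofReal_mul (by positivity), hA2]
        congr 1
        ring

lemma Phi_zero (μ ν : Measure E3) (a b : ℝ) (h : ¬ (0 < a ∧ 0 < b)) : Phi μ ν a b = 0 := by
  rw [Phi, if_neg h]

/-- **Well-posedness of `I(μ,ν)`** (Lemma 3 of the paper): for radial probability measures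
supported in the unit ball, `0 ≤ Φ_{μν}(a,b) ≤ a³b³𝟙(a⁻¹+b⁻¹>1) ≤ min(a⁶,4a³)+min(b⁶,4b³)`,
`Ψ_{μν}(a,b) ≤ 2a³b³𝟙(a⁻¹+b⁻¹>1) ≤ min(2a⁶,8a³)+min(2b⁶,8b³)`, the function
`a ↦ min(2a⁶,8a³)` belongs to `𝓕_{μν}`, `I(μ,ν) ≤ 2^{4/3}·12π` and `I(μ,μ) ≤ 2^{1/3}·12π`. -/
theorem I_wellposed (μ ν : Measure E3) [IsProbabilityMeasure μ] [IsProbabilityMeasure ν]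
    (hμrad : IsRadial μ) (hνrad : IsRadial ν)
    (hμs : μ (closedBall (0:E3) 1)ᶜ = 0) (hνs : ν (closedBall (0:E3) 1)ᶜ = 0) :
    (∀ a b : ℝ, 0 < a → 0 < b →
      0 ≤ Phi μ ν a b ∧
      Phi μ ν a b ≤ (if 1 < a⁻¹ + b⁻¹ then a ^ 3 * b ^ 3 else 0) ∧
      (if 1 < a⁻¹ + b⁻¹ then a ^ 3 * b ^ 3 else 0) ≤
        min (a ^ 6) (4 * a ^ 3) + min (b ^ 6) (4 * b ^ 3) ∧
      Psi μ ν a b ≤ (if 1 < a⁻¹ + b⁻¹ then 2 * a ^ 3 * b ^ 3 else 0) ∧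
      (if 1 < a⁻¹ + b⁻¹ then 2 * a ^ 3 * b ^ 3 else 0) ≤
        min (2 * a ^ 6) (8 * a ^ 3) + min (2 * b ^ 6) (8 * b ^ 3)) ∧
    (fun a : ℝ => min (2 * a ^ 6) (8 * a ^ 3)) ∈ FF μ ν ∧
    II μ ν ≤ ENNReal.ofReal (2 ^ ((4:ℝ)/3) * 12 * π) ∧
    II μ μ ≤ ENNReal.ofReal (2 ^ ((1:ℝ)/3) * 12 * π) := by
  have hΨ : ∀ a b : ℝ, 0 < a → 0 < b →
      Psi μ ν a b ≤ (if 1 < a⁻¹ + b⁻¹ then 2 * a ^ 3 * b ^ 3 else 0) := by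
    intro a b ha hb
    have h1 := Phi_le μ ν hμrad hνrad hμs hνs a b ha hb
    have h2 := Phi_le ν μ hνrad hμrad hνs hμs a b ha hb
    have h3 := Phi_nonneg ν ν hνrad hνrad a b
    unfold Psi
    split_ifs at h1 h2 ⊢ <;> linarith
  have hF1 : (fun a : ℝ => min (2 * a ^ 6) (8 * a ^ 3)) ∈ FF μ ν := by
    refine ⟨by fun_prop, fun a ha => by positivity, fun a b ha hb => ?_⟩
    by_cases h : 0 < a ∧ 0 < b
    · exact (hΨ a b h.1 h.2).trans (elem_ineq2 a b h.1 h.2)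
    · rw [Psi, Phi_zero _ _ _ _ h, Phi_zero _ _ _ _ h, Phi_zero _ _ _ _ h]
      simp only [add_zero, sub_zero]
      positivity
  have hF2 : (fun a : ℝ => min (a ^ 6) (4 * a ^ 3)) ∈ FF μ μ := by
    refine ⟨by fun_prop, fun a ha => by positivity, fun a b ha hb => ?_⟩
    rw [Psi, add_sub_cancel_right]
    by_cases h : 0 < a ∧ 0 < b
    · exact (Phi_le μ μ hμrad hμrad hμs hμs a b h.1 h.2).trans (elem_ineq a b h.1 h.2)
    · rw [Phi_zero _ _ _ _ h]
      positivity
  refine ⟨fun a b ha hb => ⟨Phi_nonneg μ ν hμrad hνrad a b,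
    Phi_le μ ν hμrad hνrad hμs hνs a b ha hb, elem_ineq a b ha hb, hΨ a b ha hb,
    elem_ineq2 a b ha hb⟩, hF1, ?_, ?_⟩
  · refine (iInf₂_le _ hF1).trans ?_
    simp only [min_two]
    refine (integral_bound 2 (by norm_num)).trans (le_of_eq ?_)
    congr 1
    rw [show (4:ℝ)/3 = 1 + 1/3 by norm_num, Real.rpow_add (by norm_num), Real.rpow_one]
    ring
  · refine (iInf₂_le _ hF2).trans ?_
    have := integral_bound 1 (by norm_num)
    simpa only [one_mul] using this
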